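/- arXiv:2311.00779 — 2 statements merged into one kernel-verified Lean document; each statement's English description precedes it below -/
import Mathlib

section
/- Given disjoint finite sets S and T with positive integers (s_i)_{i∈S} and (t_j)_{j∈T} satisfying ∑_{i∈S} s_i = ∑_{j∈T} t_j, the minimum cost of a transportation solution equals |S| + |T| − m, where m is the maximum size of a same-sum partition of S and T. -/
namespace PaperTransport

/-- A transportation solution for the data `s : S → ℕ`, `t : T → ℕ` with cost `c`:
nonnegative reals `x i j` with row sums `s i`, column sums `t j`, and exactly `c`
strictly positive entries. -/
def IsTransportCost {S T : Type*} [Fintype S] [Fintype T]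
    (s : S → ℕ) (t : T → ℕ) (c : ℕ) : Prop :=
  ∃ x : S → T → ℝ, (∀ i j, 0 ≤ x i j) ∧
    (∀ i, ∑ j, x i j = (s i : ℝ)) ∧ (∀ j, ∑ i, x i j = (t j : ℝ)) ∧
    c = {p : S × T | 0 < x p.1 p.2}.ncard

/-- A same-sum partition of `S` and `T` of size `m`: partitions of `S` and of `T` into
`m` nonempty parts (encoded by surjections onto `Fin m`) such that corresponding parts
have equal weight. -/
def SameSumPartition {S T : Type*} [Fintype S] [Fintype T]
    (s : S → ℕ) (t : T → ℕ) (m : ℕ) : Prop :=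
  ∃ (σ : S → Fin m) (τ : T → Fin m), Function.Surjective σ ∧ Function.Surjective τ ∧
    ∀ ℓ : Fin m,
      ∑ i ∈ Finset.univ.filter (fun i => σ i = ℓ), s i =
        ∑ j ∈ Finset.univ.filter (fun j => τ j = ℓ), t j

/-- A transportation solution on `A × B` with real weights `a`, `b` and with fewer than
`|A| + |B|` positive entries. -/
def HasForestSolution {S T : Type*} (A : Finset S) (B : Finset T) (a : S → ℝ) (b : T → ℝ) :
    Prop :=
  ∃ x : S → T → ℝ, (∀ i j, 0 ≤ x i j) ∧
    (∀ i ∈ A, ∑ j ∈ B, x i j = a i) ∧ (∀ j ∈ B, ∑ i ∈ A, x i j = b j) ∧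
    {p ∈ A ×ˢ B | 0 < x p.1 p.2}.card + 1 ≤ A.card + B.card

section ForestSolution

variable {S T : Type*} {A : Finset S} {B : Finset T} {a : S → ℝ} {b : T → ℝ}

theorem HasForestSolution.symm (h : HasForestSolution A B a b) : HasForestSolution B A b a := by
  obtain ⟨x, hx, hA, hB, hc⟩ := h
  refine ⟨fun j i => x i j, fun j i => hx i j, hB, hA, ?_⟩
  have h_card : {p ∈ B ×ˢ A | 0 < x p.2 p.1}.card ≤ {p ∈ A ×ˢ B | 0 < x p.1 p.2}.card := by
    refine Finset.card_le_card_of_injOn Prod.swap ?_ Prod.swap_injective.injOn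
    rintro ⟨j, i⟩ h
    simp_all
  dsimp only
  omega

theorem hasForestSolution_singleton (i : S) (hb : ∀ j, 0 ≤ b j) (h : a i = ∑ j ∈ B, b j) :
    HasForestSolution {i} B a b := by
  refine ⟨fun _ j => b j, fun _ j => hb j, ?_, by simp, ?_⟩
  · simp [h]
  · have := Finset.card_filter_le ({i} ×ˢ B) (fun p => 0 < b p.2)
    simp only [Finset.card_product, Finset.card_singleton] at this ⊢
    omega

theorem HasForestSolution.of_erase [DecidableEq S] [DecidableEq T] {i : S} {j : T}
    (hi : i ∈ A) (hj : j ∈ B) (ha : 0 ≤ a i)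
    (h : HasForestSolution (A.erase i) B a (Function.update b j (b j - a i))) :
    HasForestSolution A B a b := by
  obtain ⟨x, hx, hA, hB, hc⟩ := h
  refine ⟨fun i' j' => if i' = i then (if j' = j then a i else 0) else x i' j', ?_, ?_, ?_, ?_⟩
  · intro i' j'
    dsimp only
    split_ifs
    exacts [ha, le_rfl, hx _ _]
  · intro i' hi'
    by_cases h : i' = i
    · simp [h, hj]
    · simpa [h] using hA i' (Finset.mem_erase.2 ⟨h, hi'⟩)
  · intro j' hj'
    have h_erase : ∑ i' ∈ A.erase i, (if i' = i then (if j' = j then a i else 0) else x i' j') =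
        ∑ i' ∈ A.erase i, x i' j' :=
      Finset.sum_congr rfl fun i' hi' => if_neg (Finset.ne_of_mem_erase hi')
    rw [← Finset.add_sum_erase A _ hi, h_erase, hB j' hj', Function.update_apply]
    by_cases h : j' = j <;> simp [h]
  · have h_sub : {p ∈ A ×ˢ B | 0 < if p.1 = i then (if p.2 = j then a i else 0) else x p.1 p.2} ⊆
        insert (i, j) {p ∈ A.erase i ×ˢ B | 0 < x p.1 p.2} := by
      rintro ⟨i', j'⟩ h
      simp only [Finset.mem_filter, Finset.mem_product, Finset.mem_insert, Finset.mem_erase,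
        Prod.mk.injEq] at h ⊢
      by_cases h₁ : i' = i <;> by_cases h₂ : j' = j <;> simp_all
    have h_card := (Finset.card_le_card h_sub).trans (Finset.card_insert_le _ _)
    have := Finset.card_erase_add_one hi
    dsimp only
    omega

theorem exists_forestSolution (n : ℕ) : ∀ {A : Finset S} {B : Finset T} {a : S → ℝ} {b : T → ℝ},
    A.card + B.card = n → A.Nonempty → B.Nonempty → (∀ i, 0 ≤ a i) → (∀ j, 0 ≤ b j) →
    ∑ i ∈ A, a i = ∑ j ∈ B, b j → HasForestSolution A B a b := by
  classical
  induction n with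
  | zero =>
    intro A B a b hn hA
    have := hA.card_pos
    omega
  | succ n ih =>
    intro A B a b hn hA hB ha hb h
    rcases hA.exists_eq_singleton_or_nontrivial with ⟨i, rfl⟩ | hA'
    · exact hasForestSolution_singleton i hb (by simpa using h)
    rcases hB.exists_eq_singleton_or_nontrivial with ⟨j, rfl⟩ | hB'
    · exact (hasForestSolution_singleton j ha (by simpa using h.symm)).symm
    obtain ⟨i, hi⟩ := hA
    obtain ⟨j, hj⟩ := hB
    have hci := Finset.card_erase_add_one hi
    have hcj := Finset.card_erase_add_one hj
    have hsi := Finset.add_sum_erase A a hi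
    have hsj := Finset.add_sum_erase B b hj
    rcases le_total (a i) (b j) with hij | hij
    · refine .of_erase hi hj (ha i) (ih (by omega) hA'.erase_nonempty ⟨j, hj⟩ ha ?_ ?_)
      · intro j'
        rw [Function.update_apply]
        split_ifs
        exacts [sub_nonneg.2 hij, hb j']
      · rw [Finset.sum_update_of_mem hj, Finset.sdiff_singleton_eq_erase]
        linarith
    · refine (HasForestSolution.of_erase hj hi (hb j)
        (ih (by omega) ⟨i, hi⟩ hB'.erase_nonempty ?_ hb ?_).symm).symm
      · intro i'
        rw [Function.update_apply]
        split_ifs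
        exacts [sub_nonneg.2 hij, ha i']
      · rw [Finset.sum_update_of_mem hi, Finset.sdiff_singleton_eq_erase]
        linarith

end ForestSolution

/-- A finite graph has at least `|V| - |E|` connected components: there is a colouring of the
vertices, constant along edges, using at least that many colours. -/
theorem exists_coloring_constant_on_edges {V : Type*} [Fintype V] [DecidableEq V]
    (E : Finset (V × V)) :
    ∃ f : V → V, (∀ e ∈ E, f e.1 = f e.2) ∧
      Fintype.card V ≤ E.card + (Finset.univ.image f).card := by
  induction E using Finset.induction_on with
  | empty => exact ⟨id, by simp⟩
  | insert e E he ih =>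
    obtain ⟨f, hf, hc⟩ := ih
    refine ⟨fun v => if f v = f e.2 then f e.1 else f v, ?_, ?_⟩
    · intro e' he'
      rcases Finset.mem_insert.1 he' with rfl | he'
      · simp
      · simp [hf e' he']
    · have h_sub : Finset.univ.image f ⊆ insert (f e.2)
          (Finset.univ.image fun v => if f v = f e.2 then f e.1 else f v) := by
        intro w hw
        obtain ⟨v, -, rfl⟩ := Finset.mem_image.1 hw
        by_cases hv : f v = f e.2
        · simp [hv]
        · exact Finset.mem_insert_of_mem (Finset.mem_image.2 ⟨v, Finset.mem_univ _, if_neg hv⟩)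
      have h_card := (Finset.card_le_card h_sub).trans (Finset.card_insert_le _ _)
      rw [Finset.card_insert_of_notMem he]
      omega

section SameSum

variable {S T : Type*} [Fintype S] [Fintype T] {s : S → ℕ} {t : T → ℕ}

theorem SameSumPartition.le_card {m : ℕ} (h : SameSumPartition s t m) : m ≤ Fintype.card S := by
  obtain ⟨σ, -, hσ, -⟩ := h
  simpa using Fintype.card_le_of_surjective σ hσ

theorem IsTransportCost.exists_sameSumPartition (hs : ∀ i, 0 < s i) (ht : ∀ j, 0 < t j) {c : ℕ}
    (h : IsTransportCost s t c) :
    ∃ m, SameSumPartition s t m ∧ Fintype.card S + Fintype.card T ≤ c + m := by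
  classical
  obtain ⟨x, hx, hrow, hcol, rfl⟩ := h
  set P : Finset (S × T) := {p | 0 < x p.1 p.2} with hP
  have hPcard : {p : S × T | 0 < x p.1 p.2}.ncard = P.card := by
    rw [← Set.ncard_coe_finset]
    simp [hP]
  obtain ⟨f, hf, hc⟩ := exists_coloring_constant_on_edges
    (P.image fun p => ((Sum.inl p.1 : S ⊕ T), (Sum.inr p.2 : S ⊕ T)))
  have hf' : ∀ i j, x i j ≠ 0 → f (.inl i) = f (.inr j) := fun i j hij =>
    hf (.inl i, .inr j) <| Finset.mem_image.2
      ⟨(i, j), by simpa [hP] using (hx i j).lt_of_ne' hij, rfl⟩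
  let e := (Finset.univ.image f).equivFin
  let g : S ⊕ T → Fin (Finset.univ.image f).card := fun v =>
    e ⟨f v, Finset.mem_image_of_mem f (Finset.mem_univ v)⟩
  have hg : Function.Surjective g := by
    intro ℓ
    obtain ⟨⟨w, hw⟩, rfl⟩ := e.surjective ℓ
    obtain ⟨v, -, rfl⟩ := Finset.mem_image.1 hw
    exact ⟨v, rfl⟩
  have hg' : ∀ i j, x i j ≠ 0 → g (.inl i) = g (.inr j) := fun i j hij =>
    congrArg e (Subtype.ext (hf' i j hij))
  have h_same : ∀ ℓ, ∑ i ∈ Finset.univ.filter (fun i => g (.inl i) = ℓ), s i =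
      ∑ j ∈ Finset.univ.filter (fun j => g (.inr j) = ℓ), t j := by
    intro ℓ
    have h_real : ∑ i ∈ Finset.univ.filter (fun i => g (.inl i) = ℓ), (s i : ℝ) =
        ∑ j ∈ Finset.univ.filter (fun j => g (.inr j) = ℓ), (t j : ℝ) := by
      simp only [← hrow, ← hcol]
      rw [Finset.sum_comm' (t' := Finset.univ) (s' := fun _ => Finset.univ.filter
        fun i => g (.inl i) = ℓ) (by simp), Finset.sum_filter]
      refine Finset.sum_congr rfl fun j _ => ?_
      rw [Finset.sum_filter]
      split_ifs with hj
      · refine Finset.sum_congr rfl fun i _ => ite_eq_left_iff.2 fun hi => ?_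
        by_contra hij
        exact hi ((hg' i j (Ne.symm hij)).trans hj)
      · refine Finset.sum_eq_zero fun i _ => ite_eq_right_iff.2 fun hi => ?_
        by_contra hij
        exact hj ((hg' i j hij).symm.trans hi)
    exact_mod_cast h_real
  have h_pos : ∀ ℓ, (∃ i, g (.inl i) = ℓ) ↔ ∃ j, g (.inr j) = ℓ := by
    intro ℓ
    have hl : (∃ i, g (.inl i) = ℓ) ↔
        0 < ∑ i ∈ Finset.univ.filter (fun i => g (.inl i) = ℓ), s i := by
      simp [Finset.sum_pos_iff, hs]
    have hr : (∃ j, g (.inr j) = ℓ) ↔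
        0 < ∑ j ∈ Finset.univ.filter (fun j => g (.inr j) = ℓ), t j := by
      simp [Finset.sum_pos_iff, ht]
    rw [hl, hr, h_same]
  refine ⟨_, ⟨fun i => g (.inl i), fun j => g (.inr j), ?_, ?_, h_same⟩, ?_⟩
  · intro ℓ
    obtain ⟨i | j, hv⟩ := hg ℓ
    · exact ⟨i, hv⟩
    · exact (h_pos ℓ).2 ⟨j, hv⟩
  · intro ℓ
    obtain ⟨i | j, hv⟩ := hg ℓ
    · exact (h_pos ℓ).1 ⟨i, hv⟩
    · exact ⟨j, hv⟩
  · have := Finset.card_image_le (s := P)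
      (f := fun p => ((Sum.inl p.1 : S ⊕ T), (Sum.inr p.2 : S ⊕ T)))
    rw [Fintype.card_sum] at hc
    omega

theorem SameSumPartition.exists_isTransportCost {m : ℕ} (h : SameSumPartition s t m) :
    ∃ c, IsTransportCost s t c ∧ c + m ≤ Fintype.card S + Fintype.card T := by
  classical
  obtain ⟨σ, τ, hσ, hτ, hst⟩ := h
  have h_forest : ∀ ℓ, HasForestSolution (Finset.univ.filter fun i => σ i = ℓ)
      (Finset.univ.filter fun j => τ j = ℓ) (fun i => (s i : ℝ)) (fun j => (t j : ℝ)) := by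
    intro ℓ
    obtain ⟨i, hi⟩ := hσ ℓ
    obtain ⟨j, hj⟩ := hτ ℓ
    exact exists_forestSolution _ rfl ⟨i, by simpa using hi⟩ ⟨j, by simpa using hj⟩
      (fun _ => Nat.cast_nonneg _) (fun _ => Nat.cast_nonneg _) (by exact_mod_cast hst ℓ)
  choose x hx hrow hcol hc using h_forest
  refine ⟨_, ⟨fun i j => if τ j = σ i then x (σ i) i j else 0, ?_, ?_, ?_, rfl⟩, ?_⟩
  · intro i j
    dsimp only
    split_ifs
    exacts [hx _ _ _, le_rfl]
  · intro i
    rw [← Finset.sum_filter]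
    exact hrow (σ i) i (by simp)
  · intro j
    refine Eq.trans ?_ (hcol (τ j) j (by simp))
    rw [Finset.sum_filter]
    refine Finset.sum_congr rfl fun i _ => ?_
    by_cases h : σ i = τ j
    · simp [h]
    · simp [h, Ne.symm h]
  · set Q : Fin m → Finset (S × T) := fun ℓ =>
      {p ∈ (Finset.univ.filter fun i => σ i = ℓ) ×ˢ (Finset.univ.filter fun j => τ j = ℓ) |
        0 < x ℓ p.1 p.2} with hQ
    have h_sub : {p : S × T | 0 < if τ p.2 = σ p.1 then x (σ p.1) p.1 p.2 else 0} ⊆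
        (Finset.univ.biUnion Q : Finset (S × T)) := by
      rintro ⟨i, j⟩ h
      by_cases hij : τ j = σ i <;> simp_all
    have h_card : {p : S × T | 0 < if τ p.2 = σ p.1 then x (σ p.1) p.1 p.2 else 0}.ncard ≤
        ∑ ℓ, (Q ℓ).card := by
      refine (Set.ncard_le_ncard h_sub (Finset.finite_toSet _)).trans ?_
      rw [Set.ncard_coe_finset]
      exact Finset.card_biUnion_le
    have h_sum : ∑ ℓ, ((Q ℓ).card + 1) ≤ Fintype.card S + Fintype.card T := by
      refine (Finset.sum_le_sum fun ℓ _ => hc ℓ).trans_eq ?_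
      rw [Finset.sum_add_distrib,
        ← Finset.card_eq_sum_card_fiberwise fun _ _ => Finset.mem_coe.2 (Finset.mem_univ _),
        ← Finset.card_eq_sum_card_fiberwise fun _ _ => Finset.mem_coe.2 (Finset.mem_univ _),
        Finset.card_univ, Finset.card_univ]
    rw [Finset.sum_add_distrib] at h_sum
    simp only [Finset.sum_const, Finset.card_univ, Fintype.card_fin, smul_eq_mul, mul_one] at h_sum
    dsimp only
    omega

/-- The proportional solution `x i j = s i * t j / ∑ s` is a transportation solution. -/
theorem exists_isTransportCost (hsum : ∑ i, s i = ∑ j, t j) : ∃ c, IsTransportCost s t c := by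
  have hsum' : ∑ i, (s i : ℝ) = ∑ j, (t j : ℝ) := by exact_mod_cast hsum
  refine ⟨_, fun i j => s i * t j / ∑ i, (s i : ℝ), fun i j => by positivity, fun i => ?_,
    fun j => ?_, rfl⟩
  · rw [← Finset.sum_div, ← Finset.mul_sum, ← hsum']
    refine mul_div_cancel_of_imp fun h => ?_
    exact (Finset.sum_eq_zero_iff_of_nonneg fun i _ => Nat.cast_nonneg _).1 h i (Finset.mem_univ i)
  · rw [← Finset.sum_div, ← Finset.sum_mul]
    refine mul_div_cancel_left_of_imp fun h => ?_
    rw [hsum'] at h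
    exact (Finset.sum_eq_zero_iff_of_nonneg fun j _ => Nat.cast_nonneg _).1 h j (Finset.mem_univ j)

end SameSum

/-- Hultberg–Cardoso.  For positive weights with equal total sum, the
minimum cost of a transportation solution is `|S| + |T| - m`, where `m` is the maximum
size of a same-sum partition of `S` and `T`. -/
theorem pcfct_min_cost {S T : Type*} [Fintype S] [Fintype T]
    (s : S → ℕ) (t : T → ℕ) (hs : ∀ i, 0 < s i) (ht : ∀ j, 0 < t j)
    (hsum : ∑ i, s i = ∑ j, t j) :
    IsLeast {c : ℕ | IsTransportCost s t c}
      (Fintype.card S + Fintype.card T - sSup {m : ℕ | SameSumPartition s t m}) := by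
  have h_bdd : BddAbove {m : ℕ | SameSumPartition s t m} := ⟨_, fun _ h => h.le_card⟩
  have h_nonempty : {m : ℕ | SameSumPartition s t m}.Nonempty := by
    obtain ⟨_, h⟩ := exists_isTransportCost hsum
    obtain ⟨m, hm, -⟩ := h.exists_sameSumPartition hs ht
    exact ⟨m, hm⟩
  have h_lower : ∀ c, IsTransportCost s t c →
      Fintype.card S + Fintype.card T ≤ c + sSup {m : ℕ | SameSumPartition s t m} := by
    intro c h
    obtain ⟨m, hm, hc⟩ := h.exists_sameSumPartition hs ht
    exact hc.trans (Nat.add_le_add_left (le_csSup h_bdd hm) c)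
  obtain ⟨c, hc, hcm⟩ :=
    SameSumPartition.exists_isTransportCost (Nat.sSup_mem h_nonempty h_bdd)
  refine ⟨?_, fun c' h => ?_⟩
  · have := h_lower c hc
    rwa [Set.mem_ofPred_eq, show Fintype.card S + Fintype.card T -
      sSup {m : ℕ | SameSumPartition s t m} = c by omega]
  · have := h_lower c' h
    omega

end PaperTransport
end

section
/- Let p, q ∈ ℕ and let s_1,…,s_p and t_1,…,t_q be positive integers with ∑_{i=1}^p s_i = ∑_{j=1}^q t_j = N. Set n = p + q, u = (s_1,…,s_p,t_1,…,t_q) ∈ ℕⁿ, a = (s_1,…,s_p,0,…,0) ∈ ℕⁿ, b = (0,…,0,t_1,…,t_q) ∈ ℕⁿ, and P = {x ∈ ℝⁿ : 0 ≤ x_i ≤ u_i for all i, and ∑_{i=1}^n x_i = N}. Then the minimum length of a path from a to b on the skeleton of P equals the minimum cost of a transportation solution for the data (s_i)_{i∈[p]}, (t_j)_{j∈[q]}. -/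
namespace PaperBox

/-- Two distinct vertices (extreme points) `x, y` of `P` are adjacent on the skeleton of
`P` if the segment `conv{x, y}` is an extreme subset of `P`. -/
def SkeletonAdj {n : ℕ} (P : Set (Fin n → ℝ)) (x y : Fin n → ℝ) : Prop :=
  x ≠ y ∧ x ∈ P.extremePoints ℝ ∧ y ∈ P.extremePoints ℝ ∧ IsExtreme ℝ P (segment ℝ x y)

/-- A path of length `ℓ` from `a` to `b` on the skeleton of `P`: a sequence of vertices of
`P` starting at `a`, ending at `b`, with consecutive vertices adjacent on the skeleton. -/
def SkeletonPath {n : ℕ} (P : Set (Fin n → ℝ)) (a b : Fin n → ℝ) (ℓ : ℕ) : Prop :=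
  ∃ g : ℕ → Fin n → ℝ, g 0 = a ∧ g ℓ = b ∧ (∀ i ≤ ℓ, g i ∈ P.extremePoints ℝ) ∧
    ∀ i < ℓ, SkeletonAdj P (g i) (g (i + 1))

/-- A transportation solution for the data `s`, `t` with cost `c`. -/
def IsTransportCost {S T : Type*} [Fintype S] [Fintype T]
    (s : S → ℕ) (t : T → ℕ) (c : ℕ) : Prop :=
  ∃ x : S → T → ℝ, (∀ i j, 0 ≤ x i j) ∧
    (∀ i, ∑ j, x i j = (s i : ℝ)) ∧ (∀ j, ∑ i, x i j = (t j : ℝ)) ∧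
    c = {p : S × T | 0 < x p.1 p.2}.ncard

/-- The intersection of the box `[0, u]` with the hyperplane `∑ xᵢ = N`. -/
def boxSlice {ι : Type*} [Fintype ι] (u : ι → ℝ) (N : ℝ) : Set (ι → ℝ) :=
  {x | (∀ i, 0 ≤ x i ∧ x i ≤ u i) ∧ ∑ i, x i = N}

section BoxSlice

variable {ι : Type*} [Fintype ι] {u : ι → ℝ} {N : ℝ}

theorem convex_boxSlice (u : ι → ℝ) (N : ℝ) : Convex ℝ (boxSlice u N) := by
  intro x hx y hy a b ha hb hab
  refine ⟨fun i => ?_, ?_⟩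
  · have h₁ := hx.1 i
    have h₂ := hy.1 i
    simp only [Pi.add_apply, Pi.smul_apply, smul_eq_mul]
    constructor
    · nlinarith
    · have : u i = a * u i + b * u i := by rw [← add_mul, hab, one_mul]
      nlinarith
  · simp only [Pi.add_apply, Pi.smul_apply, smul_eq_mul, Finset.sum_add_distrib,
      ← Finset.mul_sum, hx.2, hy.2]
    rw [← add_mul, hab, one_mul]

theorem add_eq_add_of_eq_off_pair {x y : ι → ℝ} {i j : ι} (hij : i ≠ j)
    (h : ∀ k, k ≠ i → k ≠ j → x k = y k) (hsum : ∑ k, x k = ∑ k, y k) :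
    x i + x j = y i + y j := by
  classical
  have key : ∀ z : ι → ℝ, ∑ k, z k = z i + z j + ∑ k ∈ (Finset.univ.erase i).erase j, z k := by
    intro z
    rw [← Finset.add_sum_erase _ z (Finset.mem_univ i),
      ← Finset.add_sum_erase _ z (Finset.mem_erase.2 ⟨hij.symm, Finset.mem_univ j⟩), add_assoc]
  have h' : ∑ k ∈ (Finset.univ.erase i).erase j, x k
      = ∑ k ∈ (Finset.univ.erase i).erase j, y k :=
    Finset.sum_congr rfl fun k hk => h k (by simp_all) (by simp_all)
  rw [key, key y, h'] at hsum
  linarith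

theorem eq_of_eq_off_singleton {x y : ι → ℝ} {i : ι} (h : ∀ k, k ≠ i → x k = y k)
    (hsum : ∑ k, x k = ∑ k, y k) : x = y := by
  classical
  have h' : ∑ k ∈ Finset.univ.erase i, x k = ∑ k ∈ Finset.univ.erase i, y k :=
    Finset.sum_congr rfl fun k hk => h k (Finset.ne_of_mem_erase hk)
  rw [← Finset.add_sum_erase _ x (Finset.mem_univ i),
    ← Finset.add_sum_erase _ y (Finset.mem_univ i), h'] at hsum
  ext k
  by_cases hk : k = i
  · subst hk
    linarith
  · exact h k hk

theorem left_apply_eq_of_mem_openSegment {x y z : ι → ℝ} (hx : x ∈ boxSlice u N)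
    (hy : y ∈ boxSlice u N) (hz : z ∈ openSegment ℝ x y) {k : ι} (hk : z k = 0 ∨ z k = u k) :
    x k = z k := by
  obtain ⟨a, b, ha, hb, hab, rfl⟩ := hz
  have hxk := hx.1 k
  have hyk := hy.1 k
  simp only [Pi.add_apply, Pi.smul_apply, smul_eq_mul] at hk ⊢
  obtain rfl : b = 1 - a := by linarith
  rcases hk with hk | hk
  · rw [hk]
    have h₁ := mul_nonneg ha.le hxk.1
    have h₂ := mul_nonneg hb.le hyk.1
    exact (mul_eq_zero.1 (by linarith : a * x k = 0)).resolve_left ha.ne'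
  · rw [hk]
    have h₁ := mul_nonneg ha.le (sub_nonneg.2 hxk.2)
    have h₂ := mul_nonneg hb.le (sub_nonneg.2 hyk.2)
    have h₃ : a * (u k - x k) = 0 := by linarith
    have := (mul_eq_zero.1 h₃).resolve_left ha.ne'
    linarith

theorem mem_extremePoints_boxSlice {x : ι → ℝ} (hx : x ∈ boxSlice u N)
    (h : ∀ k l, k ≠ l → (x k = 0 ∨ x k = u k) ∨ (x l = 0 ∨ x l = u l)) :
    x ∈ (boxSlice u N).extremePoints ℝ := by
  refine mem_extremePoints_iff_left.2 ⟨hx, fun y hy z hz hxyz => ?_⟩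
  by_cases hall : ∀ k, x k = 0 ∨ x k = u k
  · exact funext fun k => left_apply_eq_of_mem_openSegment hy hz hxyz (hall k)
  · push Not at hall
    obtain ⟨i, hi⟩ := hall
    refine eq_of_eq_off_singleton (i := i) (fun k hk => ?_) (hy.2.trans hx.2.symm)
    refine left_apply_eq_of_mem_openSegment hy hz hxyz ((h i k hk.symm).resolve_left ?_)
    rintro (h' | h')
    exacts [hi.1 h', hi.2 h']

theorem isExtreme_segment_boxSlice {x y : ι → ℝ} (hx : x ∈ boxSlice u N)
    (hy : y ∈ boxSlice u N) {i j : ι} (hij : i ≠ j) (hxy : y i < x i)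
    (hoff : ∀ k, k ≠ i → k ≠ j → y k = x k)
    (hbd : ∀ k, k ≠ i → k ≠ j → x k = 0 ∨ x k = u k)
    (hxb : x i = u i ∨ x j = 0) (hyb : y i = 0 ∨ y j = u j) :
    IsExtreme ℝ (boxSlice u N) (segment ℝ x y) := by
  refine ⟨(convex_boxSlice u N).segment_subset hx hy, fun v hv w hw z hz hzvw => ?_⟩
  have hzk : ∀ k, k ≠ i → k ≠ j → z k = x k := by
    intro k hki hkj
    obtain ⟨a, b, -, -, hab, rfl⟩ := hz
    simp only [Pi.add_apply, Pi.smul_apply, smul_eq_mul, hoff k hki hkj]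
    rw [← add_mul, hab, one_mul]
  have hvk : ∀ k, k ≠ i → k ≠ j → v k = x k := by
    intro k hki hkj
    rw [← hzk k hki hkj]
    apply left_apply_eq_of_mem_openSegment hv hw hzvw
    rw [hzk k hki hkj]
    exact hbd k hki hkj
  have hvs := add_eq_add_of_eq_off_pair hij hvk (hv.2.trans hx.2.symm)
  have hys := add_eq_add_of_eq_off_pair hij hoff (hy.2.trans hx.2.symm)
  have hvi := hv.1 i
  have hvj := hv.1 j
  have hupper : v i ≤ x i := by rcases hxb with h | h <;> linarith
  have hlower : y i ≤ v i := by rcases hyb with h | h <;> linarith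
  have hpos : 0 < x i - y i := sub_pos.2 hxy
  rw [segment_eq_image]
  refine ⟨(x i - v i) / (x i - y i), ⟨by apply div_nonneg <;> linarith,
    (div_le_one hpos).2 (by linarith)⟩, ?_⟩
  have hmul := div_mul_cancel₀ (x i - v i) hpos.ne'
  ext k
  simp only [Pi.add_apply, Pi.smul_apply, smul_eq_mul]
  set θ := (x i - v i) / (x i - y i)
  by_cases hki : k = i
  · subst hki
    linarith
  by_cases hkj : k = j
  · subst hkj
    have : y k = x i + x k - y i := by linarith
    rw [this]
    linarith
  · rw [hoff k hki hkj, hvk k hki hkj]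
    ring

/-- An edge of `boxSlice u N` changes at most two coordinates. -/
theorem exists_eq_off_pair_of_isExtreme_segment {x y : ι → ℝ} (hx : x ∈ boxSlice u N)
    (hy : y ∈ boxSlice u N) (hne : x ≠ y)
    (hext : IsExtreme ℝ (boxSlice u N) (segment ℝ x y)) :
    ∃ i j, ∀ k, k ≠ i → k ≠ j → x k = y k := by
  classical
  obtain ⟨i, hi⟩ := Function.ne_iff.1 hne
  by_cases hj : ∃ j, j ≠ i ∧ x j ≠ y j
  swap
  · push Not at hj
    exact ⟨i, i, fun k hk _ => hj k hk⟩
  obtain ⟨j, hji, hj⟩ := hj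
  refine ⟨i, j, fun k hki hkj => ?_⟩
  by_contra hk
  set m : ι → ℝ := midpoint ℝ x y with hm
  have hm_apply : ∀ l, m l = (x l + y l) / 2 := by
    intro l
    simp only [hm, midpoint_eq_smul_add, Pi.smul_apply, Pi.add_apply, smul_eq_mul, invOf_eq_inv]
    ring
  have hmem : m ∈ segment ℝ x y := midpoint_mem_segment x y
  have hmP := hext.1 hmem
  have hint : ∀ l, x l ≠ y l → 0 < m l ∧ m l < u l := by
    intro l hl
    have h₁ := hx.1 l
    have h₂ := hy.1 l
    rw [hm_apply]
    rcases lt_or_gt_of_ne hl with h | h <;> constructor <;> linarith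
  obtain ⟨hi0, hiu⟩ := hint i hi
  obtain ⟨hj0, hju⟩ := hint j hj
  obtain ⟨ε, hε, hεle⟩ : ∃ ε : ℝ, 0 < ε ∧
      (ε ≤ m i ∧ ε ≤ u i - m i) ∧ (ε ≤ m j ∧ ε ≤ u j - m j) :=
    ⟨min (min (m i) (u i - m i)) (min (m j) (u j - m j)), by
      simp only [lt_min_iff]
      exact ⟨⟨hi0, by linarith⟩, hj0, by linarith⟩, by simp⟩
  have hpert : ∀ δ : ℝ, |δ| = ε → m + (Pi.single i δ - Pi.single j δ) ∈ boxSlice u N := by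
    intro δ hδ
    have hle := abs_le.1 hδ.le
    refine ⟨fun l => ?_, ?_⟩
    · have hl := hmP.1 l
      by_cases hli : l = i
      · subst hli
        simp only [Pi.add_apply, Pi.sub_apply, Pi.single_eq_same, Pi.single_eq_of_ne hji.symm]
        constructor <;> linarith
      by_cases hlj : l = j
      · subst hlj
        simp only [Pi.add_apply, Pi.sub_apply, Pi.single_eq_same, Pi.single_eq_of_ne hji]
        constructor <;> linarith
      · simpa [Pi.single_eq_of_ne hli, Pi.single_eq_of_ne hlj] using hl
    · simp [Finset.sum_add_distrib, Finset.sum_sub_distrib, hmP.2]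
  have hseg : m + (Pi.single i ε - Pi.single j ε) ∈ segment ℝ x y := by
    refine hext.2 (hpert ε (abs_of_pos hε))
      (hpert (-ε) (by rw [abs_neg, abs_of_pos hε])) hmem ⟨1 / 2, 1 / 2, by norm_num, by norm_num,
      by norm_num, ?_⟩
    ext l
    simp only [Pi.single_neg, Pi.add_apply, Pi.smul_apply, Pi.sub_apply, Pi.neg_apply, smul_eq_mul]
    ring
  rw [segment_eq_image] at hseg
  obtain ⟨θ, -, hθ⟩ := hseg
  have hθk := congrFun hθ k
  have hθi := congrFun hθ i
  simp only [Pi.add_apply, Pi.smul_apply, Pi.sub_apply, smul_eq_mul, Pi.single_eq_of_ne hki,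
    Pi.single_eq_of_ne hkj, Pi.single_eq_same, Pi.single_eq_of_ne hji.symm, hm_apply] at hθk hθi
  have hfac : (θ - 1 / 2) * (y k - x k) = 0 := by linarith
  have hhalf := (mul_eq_zero.1 hfac).resolve_right (sub_ne_zero.2 (Ne.symm hk))
  obtain rfl : θ = 1 / 2 := by linarith
  linarith

/-- Fibre sums of a function identifying `i` and `j` agree for vectors of equal total that
differ only at `i` and `j`. -/
theorem sum_fiber_eq_of_eq_off_pair {κ : Type*} [DecidableEq κ] {f : ι → κ} {x y : ι → ℝ}
    {i j : ι} (hf : f i = f j) (h : ∀ k, k ≠ i → k ≠ j → x k = y k)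
    (hsum : ∑ k, x k = ∑ k, y k) (c : κ) :
    ∑ k with f k = c, x k = ∑ k with f k = c, y k := by
  by_cases hc : f i = c
  · have hcompl : ∑ k with ¬ f k = c, x k = ∑ k with ¬ f k = c, y k := by
      refine Finset.sum_congr rfl fun k hk => h k ?_ ?_ <;> rintro rfl <;> simp_all
    rw [← Finset.sum_filter_add_sum_filter_not _ (fun k => f k = c) x,
      ← Finset.sum_filter_add_sum_filter_not _ (fun k => f k = c) y, hcompl] at hsum
    exact add_right_cancel hsum
  · refine Finset.sum_congr rfl fun k hk => h k ?_ ?_ <;> rintro rfl <;> simp_all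

end BoxSlice

/-- Merging the endpoints of the pairs in `E` one pair at a time loses at most one class per
pair. -/
theorem exists_merge_pairs {V : Type*} [Fintype V] [DecidableEq V] (E : Finset (V × V)) :
    ∃ f : V → V, (∀ e ∈ E, f e.1 = f e.2) ∧
      Fintype.card V ≤ (Finset.univ.image f).card + E.card := by
  induction E using Finset.induction_on with
  | empty => exact ⟨id, by simp⟩
  | insert e E he ih =>
    obtain ⟨f, hf, hcard⟩ := ih
    refine ⟨fun v => if f v = f e.1 then f e.2 else f v, ?_, ?_⟩
    · intro e' he'
      rcases Finset.mem_insert.1 he' with rfl | he'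
      · simp
      · simp [hf e' he']
    · have hsub : Finset.univ.image f ⊆
          insert (f e.1) (Finset.univ.image fun v => if f v = f e.1 then f e.2 else f v) := by
        intro c hc
        obtain ⟨v, -, rfl⟩ := Finset.mem_image.1 hc
        by_cases hv : f v = f e.1
        · exact Finset.mem_insert.2 (Or.inl hv)
        · exact Finset.mem_insert_of_mem
            (Finset.mem_image.2 ⟨v, Finset.mem_univ v, by simp [hv]⟩)
      have h₁ := (Finset.card_le_card hsub).trans (Finset.card_insert_le _ _)
      rw [Finset.card_insert_of_notMem he]
      omega

/-- Removing one of two identified elements `i`, `j` from `A`, or both of them, lowers the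
difference between the number of elements and the number of classes. -/
theorem card_lt_and_card_add_card_image_lt {V κ : Type*} [DecidableEq V] [DecidableEq κ]
    {f : V → κ} {A B : Finset V} {i j : V} (hij : i ≠ j) (hf : f i = f j) (hi : i ∈ A) (hj : j ∈ A)
    (hiff : ∀ k, k ≠ i → k ≠ j → (k ∈ B ↔ k ∈ A)) (hor : i ∉ B ∨ j ∉ B) :
    B.card < A.card ∧ B.card + (A.image f).card < A.card + (B.image f).card := by
  have hBA : B ⊆ A := fun k hk => by
    by_cases hki : k = i
    · rwa [hki]
    by_cases hkj : k = j
    · rwa [hkj]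
    exact (hiff k hki hkj).1 hk
  have hlt : B.card < A.card := Finset.card_lt_card
    ⟨hBA, fun h => hor.elim (fun h' => h' (h hi)) (fun h' => h' (h hj))⟩
  refine ⟨hlt, ?_⟩
  by_cases hboth : i ∉ B ∧ j ∉ B
  · have hB : B ⊆ (A.erase i).erase j := fun k hk =>
      Finset.mem_erase.2 ⟨fun h => hboth.2 (h ▸ hk),
        Finset.mem_erase.2 ⟨fun h => hboth.1 (h ▸ hk), hBA hk⟩⟩
    have hle := Finset.card_le_card hB
    have h₁ := Finset.card_erase_add_one hi
    have h₂ := Finset.card_erase_add_one (Finset.mem_erase.2 ⟨hij.symm, hj⟩)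
    have him : A.image f ⊆ insert (f i) (B.image f) := by
      intro c hc
      obtain ⟨k, hk, rfl⟩ := Finset.mem_image.1 hc
      by_cases hki : k = i
      · simp [hki]
      by_cases hkj : k = j
      · simp [hkj, hf]
      · exact Finset.mem_insert_of_mem (Finset.mem_image_of_mem f ((hiff k hki hkj).2 hk))
    have h₃ := (Finset.card_le_card him).trans (Finset.card_insert_le _ _)
    omega
  · have him : A.image f ⊆ B.image f := by
      have hfi : f i ∈ B.image f := by
        by_cases hiB : i ∈ B
        · exact Finset.mem_image_of_mem f hiB
        · rw [hf]
          exact Finset.mem_image_of_mem f (by tauto)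
      intro c hc
      obtain ⟨k, hk, rfl⟩ := Finset.mem_image.1 hc
      by_cases hki : k = i
      · rwa [hki]
      by_cases hkj : k = j
      · rwa [hkj, ← hf]
      · exact Finset.mem_image_of_mem f ((hiff k hki hkj).2 hk)
    have := Finset.card_le_card him
    omega

section Path

variable {n : ℕ} {P : Set (Fin n → ℝ)} {a b c : Fin n → ℝ} {ℓ : ℕ}

theorem skeletonPath_zero (ha : a ∈ P.extremePoints ℝ) : SkeletonPath P a a 0 :=
  ⟨fun _ => a, rfl, rfl, fun _ _ => ha, fun i hi => absurd hi (Nat.not_lt_zero i)⟩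

theorem SkeletonPath.cons (hab : SkeletonAdj P a b) (hbc : SkeletonPath P b c ℓ) :
    SkeletonPath P a c (ℓ + 1) := by
  obtain ⟨g, hg0, hgℓ, hgv, hga⟩ := hbc
  refine ⟨fun k => Nat.casesOn k a g, rfl, hgℓ, fun i hi => ?_, fun i hi => ?_⟩
  · cases i with
    | zero => exact hab.2.1
    | succ i => exact hgv i (by omega)
  · cases i with
    | zero => simpa [hg0] using hab
    | succ i => exact hga i (by omega)

/-- A path on the skeleton of `boxSlice u N` preserves the fibre sums of a labelling with at
least `n - ℓ` labels. -/
theorem SkeletonPath.exists_labelling {u : Fin n → ℝ} {N : ℝ}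
    (h : SkeletonPath (boxSlice u N) a b ℓ) :
    ∃ f : Fin n → Fin n, (∀ c, ∑ k with f k = c, a k = ∑ k with f k = c, b k) ∧
      n ≤ (Finset.univ.image f).card + ℓ := by
  obtain ⟨g, rfl, rfl, hgv, hga⟩ := h
  have hstep : ∀ m : Fin ℓ, ∃ e : Fin n × Fin n,
      ∀ k, k ≠ e.1 → k ≠ e.2 → g m k = g (m + 1) k := by
    intro m
    obtain ⟨hne, hx, hy, hext⟩ := hga m m.2
    obtain ⟨i, j, hij⟩ := exists_eq_off_pair_of_isExtreme_segment hx.1 hy.1 hne hext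
    exact ⟨(i, j), hij⟩
  choose e he using hstep
  obtain ⟨f, hf, hcard⟩ := exists_merge_pairs (Finset.univ.image e)
  refine ⟨f, fun c => ?_, ?_⟩
  · have key : ∀ m ≤ ℓ, ∑ k with f k = c, g 0 k = ∑ k with f k = c, g m k := by
      intro m
      induction m with
      | zero => simp
      | succ m ih =>
        intro hm
        rw [ih (by omega)]
        exact sum_fiber_eq_of_eq_off_pair
          (hf _ (Finset.mem_image_of_mem e (Finset.mem_univ ⟨m, hm⟩))) (he ⟨m, hm⟩)
          ((hgv m (by omega)).1.2.trans (hgv (m + 1) hm).1.2.symm) c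
    exact key ℓ le_rfl
  · have h₁ : (Finset.univ.image e).card ≤ ℓ := by
      simpa using Finset.card_image_le (s := Finset.univ) (f := e)
    rw [Fintype.card_fin] at hcard
    omega

end Path

section Greedy

variable {p q : ℕ} {σ α : Fin p → ℝ} {τ β : Fin q → ℝ}

theorem castAdd_ne_natAdd (i : Fin p) (j : Fin q) : Fin.castAdd q i ≠ Fin.natAdd p j := by
  simp only [ne_eq, Fin.ext_iff, Fin.val_castAdd, Fin.val_natAdd]
  omega

/-- The supplies `α` and demands `β` have the same total on every fibre of the labelling `f`. -/
def IsBalanced {κ : Type*} [DecidableEq κ] (f : Fin (p + q) → κ) (α : Fin p → ℝ)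
    (β : Fin q → ℝ) : Prop :=
  ∀ c, ∑ i with f (Fin.castAdd q i) = c, α i = ∑ j with f (Fin.natAdd p j) = c, β j

theorem sum_filter_append {κ : Type*} [DecidableEq κ] (f : Fin (p + q) → κ) (α : Fin p → ℝ)
    (β : Fin q → ℝ) (c : κ) :
    ∑ k with f k = c, Fin.append α β k =
      ∑ i with f (Fin.castAdd q i) = c, α i + ∑ j with f (Fin.natAdd p j) = c, β j := by
  simp [Finset.sum_filter, Fin.sum_univ_add]

/-- Residual supplies `α` and demands `β` of a transportation problem `σ`, `τ` balanced with
respect to `f`, at most one of which is neither untouched nor exhausted. -/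
structure IsResidual (f : Fin (p + q) → Fin (p + q)) (σ : Fin p → ℝ) (τ : Fin q → ℝ)
    (α : Fin p → ℝ) (β : Fin q → ℝ) : Prop where
  supply : ∀ i, 0 ≤ α i ∧ α i ≤ σ i
  demand : ∀ j, 0 ≤ β j ∧ β j ≤ τ j
  balanced : IsBalanced f α β
  almost : ∀ k l, k ≠ l → (Fin.append α β k = 0 ∨ Fin.append α β k = Fin.append σ τ k) ∨
    (Fin.append α β l = 0 ∨ Fin.append α β l = Fin.append σ τ l)

namespace IsResidual

variable {f : Fin (p + q) → Fin (p + q)}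

theorem sum_eq (h : IsResidual f σ τ α β) : ∑ i, α i = ∑ j, β j := by
  rw [← Finset.sum_fiberwise _ (fun i => f (Fin.castAdd q i)) α,
    ← Finset.sum_fiberwise _ (fun j => f (Fin.natAdd p j)) β]
  exact Finset.sum_congr rfl fun c _ => h.balanced c

/-- The vertex at which `α` is still to be shipped and `β` is still to be received. -/
theorem mem_boxSlice (h : IsResidual f σ τ α β) :
    Fin.append α (τ - β) ∈ boxSlice (Fin.append σ τ) (∑ j, τ j) := by
  refine ⟨fun k => ?_, ?_⟩
  · refine Fin.addCases (fun i => ?_) (fun j => ?_) k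
    · simpa using h.supply i
    · simpa using (h.demand j).symm
  · simp [Fin.sum_univ_add, h.sum_eq]

theorem extremal_vertex {k : Fin (p + q)}
    (h : Fin.append α β k = 0 ∨ Fin.append α β k = Fin.append σ τ k) :
    Fin.append α (τ - β) k = 0 ∨ Fin.append α (τ - β) k = Fin.append σ τ k := by
  induction k using Fin.addCases with
  | left i => simpa using h
  | right j =>
    simp only [Fin.append_right, Pi.sub_apply] at h ⊢
    rcases h with h | h
    · right
      linarith
    · left
      linarith

theorem mem_extremePoints (h : IsResidual f σ τ α β) :
    Fin.append α (τ - β) ∈ (boxSlice (Fin.append σ τ) (∑ j, τ j)).extremePoints ℝ :=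
  mem_extremePoints_boxSlice h.mem_boxSlice fun k l hkl =>
    (h.almost k l hkl).imp extremal_vertex extremal_vertex

/-- Unless everything has been shipped, some supply and some demand of the same class can be
matched so that all partially exhausted coordinates are involved. -/
theorem exists_pair (h : IsResidual f σ τ α β) (hne : ∃ k, Fin.append α β k ≠ 0) :
    ∃ i j, f (Fin.castAdd q i) = f (Fin.natAdd p j) ∧ 0 < α i ∧ 0 < β j ∧
      (∀ k, k ≠ Fin.castAdd q i → k ≠ Fin.natAdd p j →
        Fin.append α β k = 0 ∨ Fin.append α β k = Fin.append σ τ k) ∧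
      (α i = σ i ∨ β j = τ j) := by
  obtain ⟨k, hk, hext⟩ : ∃ k, Fin.append α β k ≠ 0 ∧
      ∀ l, l ≠ k → Fin.append α β l = 0 ∨ Fin.append α β l = Fin.append σ τ l := by
    by_cases hall : ∀ k, Fin.append α β k = 0 ∨ Fin.append α β k = Fin.append σ τ k
    · obtain ⟨k, hk⟩ := hne
      exact ⟨k, hk, fun l _ => hall l⟩
    · push Not at hall
      obtain ⟨k, hk0, hku⟩ := hall
      exact ⟨k, hk0, fun l hl => (h.almost l k hl).resolve_right (by tauto)⟩
  induction k using Fin.addCases with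
  | left i =>
    have hi : 0 < α i := (h.supply i).1.lt_of_ne' (by simpa using hk)
    have hsum : ∑ j with f (Fin.natAdd p j) = f (Fin.castAdd q i), β j ≠ 0 := by
      rw [← h.balanced]
      exact (Finset.sum_pos' (fun i _ => (h.supply i).1) ⟨i, by simp, hi⟩).ne'
    obtain ⟨j, hj, hβ⟩ := Finset.exists_ne_zero_of_sum_ne_zero hsum
    refine ⟨i, j, (Finset.mem_filter.1 hj).2.symm, hi, (h.demand j).1.lt_of_ne' hβ,
      fun k hk _ => hext k hk, Or.inr ?_⟩
    simpa [hβ] using hext _ (castAdd_ne_natAdd i j).symm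
  | right j =>
    have hj : 0 < β j := (h.demand j).1.lt_of_ne' (by simpa using hk)
    have hsum : ∑ i with f (Fin.castAdd q i) = f (Fin.natAdd p j), α i ≠ 0 := by
      rw [h.balanced]
      exact (Finset.sum_pos' (fun j _ => (h.demand j).1) ⟨j, by simp, hj⟩).ne'
    obtain ⟨i, hi, hα⟩ := Finset.exists_ne_zero_of_sum_ne_zero hsum
    refine ⟨i, j, (Finset.mem_filter.1 hi).2, (h.supply i).1.lt_of_ne' hα, hj,
      fun k _ hk => hext k hk, Or.inl ?_⟩
    simpa [hα] using hext _ (castAdd_ne_natAdd i j)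

end IsResidual

theorem append_sub_single_of_ne (α : Fin p → ℝ) (β : Fin q → ℝ) (x y : ℝ) {i : Fin p} {j : Fin q}
    {k : Fin (p + q)} (hi : k ≠ Fin.castAdd q i) (hj : k ≠ Fin.natAdd p j) :
    Fin.append (α - Pi.single i x) (β - Pi.single j y) k = Fin.append α β k := by
  induction k using Fin.addCases with
  | left i' =>
    have : i' ≠ i := fun h => hi (h ▸ rfl)
    simp [this]
  | right j' =>
    have : j' ≠ j := fun h => hj (h ▸ rfl)
    simp [this]

/-- Shipping `min (α i) (β j)` from `i` to `j` turns residual data into residual data. -/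
theorem IsResidual.ship {f : Fin (p + q) → Fin (p + q)} (h : IsResidual f σ τ α β) {i : Fin p}
    {j : Fin q} (hf : f (Fin.castAdd q i) = f (Fin.natAdd p j))
    (hext : ∀ k, k ≠ Fin.castAdd q i → k ≠ Fin.natAdd p j →
        Fin.append α β k = 0 ∨ Fin.append α β k = Fin.append σ τ k) :
    IsResidual f σ τ (α - Pi.single i (min (α i) (β j))) (β - Pi.single j (min (α i) (β j))) where
  supply i' := by
    have h' := h.supply i'
    by_cases hi : i' = i
    · subst hi
      have := min_le_left (α i') (β j)
      have := le_min h'.1 (h.demand j).1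
      simp only [Pi.sub_apply, Pi.single_eq_same]
      constructor <;> linarith
    · simpa [hi] using h'
  demand j' := by
    have h' := h.demand j'
    by_cases hj : j' = j
    · subst hj
      have := min_le_right (α i) (β j')
      have := le_min (h.supply i).1 h'.1
      simp only [Pi.sub_apply, Pi.single_eq_same]
      constructor <;> linarith
    · simpa [hj] using h'
  balanced c := by
    simp only [Pi.sub_apply, Finset.sum_sub_distrib, h.balanced c]
    congr 1
    simp [Pi.single_apply, ← hf]
  almost k l hkl := by
    have hext' : ∀ k, k ≠ Fin.castAdd q i → k ≠ Fin.natAdd p j →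
        Fin.append (α - Pi.single i (min (α i) (β j))) (β - Pi.single j (min (α i) (β j))) k = 0 ∨
        Fin.append (α - Pi.single i (min (α i) (β j))) (β - Pi.single j (min (α i) (β j))) k =
          Fin.append σ τ k := by
      intro k hi hj
      rw [append_sub_single_of_ne _ _ _ _ hi hj]
      exact hext k hi hj
    rcases le_total (α i) (β j) with hle | hle
    · have hall : ∀ k, k ≠ Fin.natAdd p j →
          Fin.append (α - Pi.single i (min (α i) (β j))) (β - Pi.single j (min (α i) (β j))) k = 0 ∨
          Fin.append (α - Pi.single i (min (α i) (β j))) (β - Pi.single j (min (α i) (β j))) k =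
            Fin.append σ τ k := by
        intro k hj
        by_cases hi : k = Fin.castAdd q i
        · left
          simp [hi, hle]
        · exact hext' k hi hj
      by_cases hk : k = Fin.natAdd p j
      · exact Or.inr (hall l (hk ▸ hkl.symm))
      · exact Or.inl (hall k hk)
    · have hall : ∀ k, k ≠ Fin.castAdd q i →
          Fin.append (α - Pi.single i (min (α i) (β j))) (β - Pi.single j (min (α i) (β j))) k = 0 ∨
          Fin.append (α - Pi.single i (min (α i) (β j))) (β - Pi.single j (min (α i) (β j))) k =
            Fin.append σ τ k := by
        intro k hi
        by_cases hj : k = Fin.natAdd p j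
        · left
          simp [hj, hle]
        · exact hext' k hi hj
      by_cases hk : k = Fin.castAdd q i
      · exact Or.inr (hall l (hk ▸ hkl.symm))
      · exact Or.inl (hall k hk)

/-- The greedy transportation solution and the path on the skeleton that it traces out. -/
theorem IsResidual.exists_path_and_transport {f : Fin (p + q) → Fin (p + q)}
    (h : IsResidual f σ τ α β) :
    ∃ ℓ, SkeletonPath (boxSlice (Fin.append σ τ) (∑ j, τ j))
        (Fin.append α (τ - β)) (Fin.append 0 τ) ℓ ∧
      (∃ x : Fin p → Fin q → ℝ, (∀ i j, 0 ≤ x i j) ∧ (∀ i, ∑ j, x i j = α i) ∧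
        (∀ j, ∑ i, x i j = β j) ∧ {e : Fin p × Fin q | 0 < x e.1 e.2}.ncard ≤ ℓ) ∧
      ℓ + ((Finset.univ.filter fun k => Fin.append α β k ≠ 0).image f).card ≤
        (Finset.univ.filter fun k => Fin.append α β k ≠ 0).card := by
  induction hm : (Finset.univ.filter fun k => Fin.append α β k ≠ 0).card
    using Nat.strong_induction_on generalizing α β with
  | _ m ih =>
    by_cases hne : ∃ k, Fin.append α β k ≠ 0
    swap
    · push Not at hne
      have hα : α = 0 := funext fun i => by simpa using hne (Fin.castAdd q i)
      have hβ : β = 0 := funext fun j => by simpa using hne (Fin.natAdd p j)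
      subst hα hβ
      refine ⟨0, ?_, ⟨0, by simp, by simp, by simp, by simp⟩, by simp [hne]⟩
      have := skeletonPath_zero h.mem_extremePoints
      rwa [sub_zero] at this ⊢
    obtain ⟨i, j, hf, hi, hj, hext, hfull⟩ := h.exists_pair hne
    have hd : 0 < min (α i) (β j) := lt_min hi hj
    have h' := h.ship hf hext
    have hoff : ∀ k, k ≠ Fin.castAdd q i → k ≠ Fin.natAdd p j →
        Fin.append (α - Pi.single i (min (α i) (β j))) (β - Pi.single j (min (α i) (β j))) k =
          Fin.append α β k := fun k => append_sub_single_of_ne _ _ _ _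
    have hoff' : ∀ k, k ≠ Fin.castAdd q i → k ≠ Fin.natAdd p j →
        Fin.append (α - Pi.single i (min (α i) (β j)))
          (τ - (β - Pi.single j (min (α i) (β j)))) k = Fin.append α (τ - β) k := by
      intro k hki hkj
      rw [← append_sub_single_of_ne α (τ - β) (min (α i) (β j)) (-min (α i) (β j)) hki hkj,
        Pi.single_neg, sub_neg_eq_add, sub_sub_eq_add_sub, add_sub_right_comm]
    have hij := castAdd_ne_natAdd i j
    have hadj : SkeletonAdj (boxSlice (Fin.append σ τ) (∑ j, τ j)) (Fin.append α (τ - β))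
        (Fin.append (α - Pi.single i (min (α i) (β j)))
          (τ - (β - Pi.single j (min (α i) (β j))))) := by
      have hlt : Fin.append (α - Pi.single i (min (α i) (β j)))
          (τ - (β - Pi.single j (min (α i) (β j)))) (Fin.castAdd q i) <
          Fin.append α (τ - β) (Fin.castAdd q i) := by
        simpa using ⟨hi, hj⟩
      refine ⟨fun heq => hlt.ne' (congrFun heq _), h.mem_extremePoints, h'.mem_extremePoints,
        isExtreme_segment_boxSlice h.mem_boxSlice h'.mem_boxSlice hij hlt hoff'
          (fun k hki hkj => extremal_vertex (hext k hki hkj)) ?_ ?_⟩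
      · refine hfull.imp (fun h => by simpa using h) fun h => by simp [h]
      · rcases le_total (α i) (β j) with hle | hle
        · left
          simp [hle]
        · right
          simp [hle]
    have hcard := card_lt_and_card_add_card_image_lt
      (A := Finset.univ.filter fun k => Fin.append α β k ≠ 0)
      (B := Finset.univ.filter fun k => Fin.append (α - Pi.single i (min (α i) (β j)))
        (β - Pi.single j (min (α i) (β j))) k ≠ 0) hij hf (by simpa using hi.ne')
      (by simpa using hj.ne') (fun k hki hkj => by simp [hoff k hki hkj]) (by
        rcases le_total (α i) (β j) with hle | hle
        · left
          simp [hle]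
        · right
          simp [hle])
    obtain ⟨ℓ, hpath, ⟨x, hx0, hxα, hxβ, hxc⟩, hℓ⟩ := ih _ (hm ▸ hcard.1) h' rfl
    refine ⟨ℓ + 1, hpath.cons hadj,
      ⟨fun i' j' => x i' j' + if i' = i then if j' = j then min (α i) (β j) else 0 else 0,
        fun i' j' => ?_, fun i' => ?_, fun j' => ?_, ?_⟩, by omega⟩
    · refine add_nonneg (hx0 i' j') ?_
      split_ifs
      exacts [hd.le, le_rfl, le_rfl]
    · rw [Finset.sum_add_distrib, hxα]
      by_cases hi' : i' = i
      · subst hi'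
        simp
      · simp [hi']
    · rw [Finset.sum_add_distrib, hxβ]
      by_cases hj' : j' = j
      · subst hj'
        simp
      · simp [hj']
    · refine (Set.ncard_le_ncard (t := insert (i, j) {e : Fin p × Fin q | 0 < x e.1 e.2})
        (fun e he => ?_) (Set.toFinite _)).trans ((Set.ncard_insert_le _ _).trans (by omega))
      by_cases heq : e.1 = i ∧ e.2 = j
      · exact Or.inl (Prod.ext heq.1 heq.2)
      · right
        have hpos : 0 < x e.1 e.2 + if e.1 = i then if e.2 = j then min (α i) (β j) else 0 else 0 :=
          he
        rwa [← ite_and, if_neg heq, add_zero] at hpos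

/-- A transportation solution is balanced with respect to some labelling with at least as many
labels as the number of coordinates minus its cost. -/
theorem exists_labelling_of_transport {x : Fin p → Fin q → ℝ} (hx : ∀ i j, 0 ≤ x i j)
    (hα : ∀ i, ∑ j, x i j = α i) (hβ : ∀ j, ∑ i, x i j = β j) :
    ∃ f : Fin (p + q) → Fin (p + q), IsBalanced f α β ∧
      p + q ≤ (Finset.univ.image f).card + {e : Fin p × Fin q | 0 < x e.1 e.2}.ncard := by
  classical
  obtain ⟨f, hf, hcard⟩ := exists_merge_pairs
    ((Finset.univ.filter fun e : Fin p × Fin q => 0 < x e.1 e.2).image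
      fun e => (Fin.castAdd q e.1, Fin.natAdd p e.2))
  have hf' : ∀ i j, x i j ≠ 0 → f (Fin.castAdd q i) = f (Fin.natAdd p j) := fun i j hij =>
    hf (Fin.castAdd q i, Fin.natAdd p j) (Finset.mem_image.2
      ⟨(i, j), by simpa using (hx i j).lt_of_ne' hij, rfl⟩)
  refine ⟨f, fun c => ?_, ?_⟩
  · simp only [← hα, ← hβ, Finset.sum_filter]
    calc ∑ i, (if f (Fin.castAdd q i) = c then ∑ j, x i j else 0)
        = ∑ i, ∑ j, if f (Fin.castAdd q i) = c then x i j else 0 :=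
          Finset.sum_congr rfl fun i _ => by split_ifs <;> simp
      _ = ∑ i, ∑ j, if f (Fin.natAdd p j) = c then x i j else 0 :=
          Finset.sum_congr rfl fun i _ => Finset.sum_congr rfl fun j _ => by
            by_cases hij : x i j = 0
            · simp [hij]
            · rw [hf' i j hij]
      _ = ∑ j, ∑ i, if f (Fin.natAdd p j) = c then x i j else 0 := Finset.sum_comm
      _ = ∑ j, (if f (Fin.natAdd p j) = c then ∑ i, x i j else 0) :=
          Finset.sum_congr rfl fun j _ => by split_ifs <;> simp
  · rw [Fintype.card_fin] at hcard
    have h₁ := Finset.card_image_le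
      (s := Finset.univ.filter fun e : Fin p × Fin q => 0 < x e.1 e.2)
      (f := fun e => (Fin.castAdd q e.1, Fin.natAdd p e.2))
    rw [Set.ncard_eq_toFinset_card', Set.toFinset_ofPred]
    omega

end Greedy

/-- With `n = p + q`, `u = (s₁,…,s_p,t₁,…,t_q)`,
`a = (s₁,…,s_p,0,…,0)`, `b = (0,…,0,t₁,…,t_q)` and
`P = {x ∈ ℝⁿ : 0 ≤ xᵢ ≤ uᵢ, ∑ xᵢ = N}`, the minimum length of a path from `a` to `b`
on the skeleton of `P` equals the minimum cost of a transportation solution for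
`(sᵢ), (tⱼ)`. -/
theorem min_skeleton_path_eq_min_transport_cost (p q : ℕ)
    (s : Fin p → ℕ) (t : Fin q → ℕ) (N : ℕ)
    (hs : ∀ i, 0 < s i) (ht : ∀ j, 0 < t j)
    (hsN : ∑ i, s i = N) (htN : ∑ j, t j = N) :
    ∃ k : ℕ,
      IsLeast {ℓ : ℕ | SkeletonPath
        {x : Fin (p + q) → ℝ |
          (∀ i, 0 ≤ x i ∧ x i ≤ Fin.addCases (fun i₁ => (s i₁ : ℝ)) (fun j₁ => (t j₁ : ℝ)) i) ∧
          ∑ i, x i = (N : ℝ)}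
        (Fin.addCases (fun i₁ => (s i₁ : ℝ)) (fun _ => 0))
        (Fin.addCases (fun _ => 0) (fun j₁ => (t j₁ : ℝ))) ℓ} k ∧
      IsLeast {c : ℕ | IsTransportCost s t c} k := by
  let σ : Fin p → ℝ := fun i => s i
  let τ : Fin q → ℝ := fun j => t j
  have hτN : ∑ j, τ j = (N : ℝ) := by simp [τ, ← htN]
  have hσN : ∑ i, σ i = (N : ℝ) := by simp [σ, ← hsN]
  change ∃ k : ℕ,
    IsLeast {ℓ : ℕ | SkeletonPath (boxSlice (Fin.append σ τ) (N : ℝ)) (Fin.append σ 0)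
      (Fin.append 0 τ) ℓ} k ∧ IsLeast {c : ℕ | IsTransportCost s t c} k
  have hbuild : ∀ f : Fin (p + q) → Fin (p + q), IsBalanced f σ τ →
      ∃ ℓ, ℓ + (Finset.univ.image f).card ≤ p + q ∧
        SkeletonPath (boxSlice (Fin.append σ τ) (N : ℝ)) (Fin.append σ 0) (Fin.append 0 τ) ℓ ∧
        ∃ c ≤ ℓ, IsTransportCost s t c := by
    intro f hf
    have hres : IsResidual f σ τ σ τ :=
      ⟨fun i => ⟨Nat.cast_nonneg _, le_rfl⟩, fun j => ⟨Nat.cast_nonneg _, le_rfl⟩, hf,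
        fun _ _ _ => Or.inl (Or.inr rfl)⟩
    have hpos : ∀ k, Fin.append σ τ k ≠ 0 :=
      Fin.addCases (fun i => by simpa [σ] using (hs i).ne') fun j => by simpa [τ] using (ht j).ne'
    obtain ⟨ℓ, hpath, ⟨x, hx0, hxα, hxβ, hxc⟩, hℓ⟩ := hres.exists_path_and_transport
    rw [sub_self, hτN] at hpath
    rw [Finset.filter_true_of_mem fun k _ => hpos k, Finset.card_univ, Fintype.card_fin] at hℓ
    exact ⟨ℓ, hℓ, hpath, _, hxc, x, hx0, hxα, hxβ, rfl⟩
  have hpath : ∀ ℓ, SkeletonPath (boxSlice (Fin.append σ τ) (N : ℝ)) (Fin.append σ 0)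
      (Fin.append 0 τ) ℓ → ∃ c ≤ ℓ, IsTransportCost s t c := by
    intro ℓ hℓ
    obtain ⟨f, hf, hcard⟩ := hℓ.exists_labelling
    obtain ⟨ℓ', hℓ', -, c, hc, hcost⟩ := hbuild f fun c => by
      simpa [sum_filter_append] using hf c
    exact ⟨c, by omega, hcost⟩
  have htransport : ∀ c, IsTransportCost s t c → ∃ ℓ ≤ c,
      SkeletonPath (boxSlice (Fin.append σ τ) (N : ℝ)) (Fin.append σ 0) (Fin.append 0 τ) ℓ := by
    rintro c ⟨x, hx0, hxα, hxβ, rfl⟩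
    obtain ⟨f, hf, hcard⟩ := exists_labelling_of_transport (α := σ) (β := τ) hx0 hxα hxβ
    obtain ⟨ℓ, hℓ, hp, -⟩ := hbuild f hf
    exact ⟨ℓ, by omega, hp⟩
  have hne : ∃ c, IsTransportCost s t c := by
    obtain ⟨f, hf⟩ : ∃ f : Fin (p + q) → Fin (p + q), IsBalanced f σ τ := by
      obtain hn | ⟨⟨v⟩⟩ := isEmpty_or_nonempty (Fin (p + q))
      · exact ⟨id, fun c => isEmptyElim c⟩
      · refine ⟨fun _ => v, fun c => ?_⟩
        by_cases hc : v = c <;> simp [hc, hσN, hτN]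
    obtain ⟨_, -, -, c, -, hc⟩ := hbuild f hf
    exact ⟨c, hc⟩
  classical
  have hmin := Nat.find_spec hne
  obtain ⟨ℓ, hℓ, hp⟩ := htransport _ hmin
  have hlower : Nat.find hne ∈ lowerBounds {ℓ : ℕ | SkeletonPath
      (boxSlice (Fin.append σ τ) (N : ℝ)) (Fin.append σ 0) (Fin.append 0 τ) ℓ} := by
    intro m hm
    obtain ⟨c, hc, hcost⟩ := hpath m hm
    exact (Nat.find_min' hne hcost).trans hc
  have heq : ℓ = Nat.find hne := le_antisymm hℓ (hlower hp)
  exact ⟨Nat.find hne, ⟨heq ▸ hp, hlower⟩, hmin, fun c hc => Nat.find_min' hne hc⟩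

end PaperBox
end
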